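/- Let s, h, k be non-negative integers with 0 < s + h ≤ n and k < m. Then C_{s,h,k} is a qOAC if and only if 0 < min{h,k} ≤ ⌊(m−1)/(m−max{h,k})⌋. -/

import Mathlib

open Matrix

/-- The maximum rank of a rank-metric code (an `𝔽`-linear subspace of `n × m` matrices). -/
noncomputable def maxrk {𝔽 : Type*} [Field 𝔽] {n m : ℕ}
    (C : Submodule 𝔽 (Matrix (Fin n) (Fin m) 𝔽)) : ℕ :=
  sSup (Matrix.rank '' (C : Set (Matrix (Fin n) (Fin m) 𝔽)))

/-- The dual code with respect to the trace bilinear form `⟨M, N⟩ = Tr(M Nᵗ)`. -/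
def dualCode {𝔽 : Type*} [Field 𝔽] {n m : ℕ}
    (C : Submodule 𝔽 (Matrix (Fin n) (Fin m) 𝔽)) :
    Submodule 𝔽 (Matrix (Fin n) (Fin m) 𝔽) where
  carrier := {M | ∀ N ∈ C, Matrix.trace (M * Nᵀ) = 0}
  add_mem' := by
    intro a b ha hb N hN
    show Matrix.trace ((a + b) * Nᵀ) = 0
    rw [Matrix.add_mul, Matrix.trace_add, ha N hN, hb N hN, add_zero]
  zero_mem' := by
    intro N hN
    simp
  smul_mem' := by
    intro c a ha N hN
    show Matrix.trace ((c • a) * Nᵀ) = 0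
    rw [Matrix.smul_mul, Matrix.trace_smul, ha N hN, smul_zero]

/-- `C` is an optimal anticode if `dim C = m * maxrk C`. -/
def isOptAnticode {𝔽 : Type*} [Field 𝔽] {n m : ℕ}
    (C : Submodule 𝔽 (Matrix (Fin n) (Fin m) 𝔽)) : Prop :=
  Module.finrank 𝔽 C = m * maxrk C

/-- `C` is a quasi optimal anticode if `m ∤ dim C` and `maxrk C = ⌈dim C / m⌉`. -/
def isQOAC {𝔽 : Type*} [Field 𝔽] {n m : ℕ}
    (C : Submodule 𝔽 (Matrix (Fin n) (Fin m) 𝔽)) : Prop :=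
  ¬ (m ∣ Module.finrank 𝔽 C) ∧
    (maxrk C : ℤ) = ⌈(Module.finrank 𝔽 C : ℚ) / (m : ℚ)⌉

/-- `C` is a dually quasi optimal anticode if both `C` and `C^⊥` are qOACs. -/
def isDuallyQOAC {𝔽 : Type*} [Field 𝔽] {n m : ℕ}
    (C : Submodule 𝔽 (Matrix (Fin n) (Fin m) 𝔽)) : Prop :=
  isQOAC C ∧ isQOAC (dualCode C)

/-- The code of matrices vanishing at all positions `(i, j)` with `¬ P i j`. -/
def zeroOutside {𝔽 : Type*} [Field 𝔽] {n m : ℕ} (P : Fin n → Fin m → Prop) :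
    Submodule 𝔽 (Matrix (Fin n) (Fin m) 𝔽) where
  carrier := {M | ∀ i j, ¬ P i j → M i j = 0}
  add_mem' := by
    intro a b ha hb i j h
    simp [Matrix.add_apply, ha i j h, hb i j h]
  zero_mem' := by
    intro i j h
    simp
  smul_mem' := by
    intro c a ha i j h
    simp [Matrix.smul_apply, ha i j h]

/-- `Mat(V)`: the matrices all of whose columns lie in `V ⊆ 𝔽^n`. -/
def matCol {𝔽 : Type*} [Field 𝔽] {n m : ℕ} (V : Submodule 𝔽 (Fin n → 𝔽)) :
    Submodule 𝔽 (Matrix (Fin n) (Fin m) 𝔽) where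
  carrier := {M | ∀ j, (fun i => M i j) ∈ V}
  add_mem' := by
    intro a b ha hb j
    exact V.add_mem (ha j) (hb j)
  zero_mem' := by
    intro j
    exact V.zero_mem
  smul_mem' := by
    intro c a ha j
    exact V.smul_mem c (ha j)

/-- `Mat(U)ᵗ`: the matrices all of whose rows lie in `U ⊆ 𝔽^m`. -/
def matRow {𝔽 : Type*} [Field 𝔽] {n m : ℕ} (U : Submodule 𝔽 (Fin m → 𝔽)) :
    Submodule 𝔽 (Matrix (Fin n) (Fin m) 𝔽) where
  carrier := {M | ∀ i, M i ∈ U}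
  add_mem' := by
    intro a b ha hb i
    exact U.add_mem (ha i) (hb i)
  zero_mem' := by
    intro i
    exact U.zero_mem
  smul_mem' := by
    intro c a ha i
    exact U.smul_mem c (ha i)

/-- `⟨e_1, …, e_s⟩ ⊆ 𝔽^ℓ`: the span of the first `s` canonical basis vectors. -/
def spanFirst (𝔽 : Type*) [Field 𝔽] (ℓ s : ℕ) : Submodule 𝔽 (Fin ℓ → 𝔽) :=
  Submodule.span 𝔽 ((fun i : Fin ℓ => Pi.single i (1 : 𝔽)) '' {i : Fin ℓ | (i : ℕ) < s})

/-- Orthogonal complement with respect to the standard dot product on `𝔽^ℓ`. -/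
def perp {𝔽 : Type*} [Field 𝔽] {ℓ : ℕ} (W : Submodule 𝔽 (Fin ℓ → 𝔽)) :
    Submodule 𝔽 (Fin ℓ → 𝔽) where
  carrier := {v | ∀ w ∈ W, ∑ i, v i * w i = 0}
  add_mem' := by
    intro a b ha hb w hw
    simp [add_mul, Finset.sum_add_distrib, ha w hw, hb w hw]
  zero_mem' := by
    intro w hw
    simp
  smul_mem' := by
    intro c a ha w hw
    simp [mul_assoc, ← Finset.mul_sum, ha w hw]

/-- Equivalence of rank-metric codes: `C = {N A M : A ∈ D}` for invertible `N, M`, or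
(when `n = m`) `C = {N Aᵗ M : A ∈ D}` for invertible `N, M`. -/
def equivCode {𝔽 : Type*} [Field 𝔽] {n m : ℕ}
    (C D : Submodule 𝔽 (Matrix (Fin n) (Fin m) 𝔽)) : Prop :=
  (∃ (N : Matrix (Fin n) (Fin n) 𝔽) (M : Matrix (Fin m) (Fin m) 𝔽),
      IsUnit N ∧ IsUnit M ∧
      (C : Set (Matrix (Fin n) (Fin m) 𝔽)) = (fun A : Matrix (Fin n) (Fin m) 𝔽 => N * A * M) '' (D : Set (Matrix (Fin n) (Fin m) 𝔽))) ∨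
  (∃ (h : n = m) (N : Matrix (Fin n) (Fin n) 𝔽) (M : Matrix (Fin m) (Fin m) 𝔽),
      IsUnit N ∧ IsUnit M ∧
      (C : Set (Matrix (Fin n) (Fin m) 𝔽)) =
        (fun A : Matrix (Fin n) (Fin m) 𝔽 =>
          N * (Matrix.reindex (finCongr h.symm) (finCongr h) Aᵀ) * M) ''
          (D : Set (Matrix (Fin n) (Fin m) 𝔽)))

/-- The Gaussian `q`-binomial coefficient, as a rational number. -/
def gaussBinom (q a r : ℕ) : ℚ :=
  (∏ i ∈ Finset.range r, ((q : ℚ) ^ a - (q : ℚ) ^ i)) /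
    (∏ i ∈ Finset.range r, ((q : ℚ) ^ r - (q : ℚ) ^ i))

/-- `φ_q(a, b, r)`: the number of rank-`r` matrices in `𝔽_q^{a×b}`. -/
def phiq (q a b r : ℕ) : ℚ :=
  gaussBinom q a r * ∏ i ∈ Finset.range r, ((q : ℚ) ^ b - (q : ℚ) ^ i)


theorem Matrix.rank_add_le {𝔽 : Type*} [Field 𝔽] {n m : ℕ} (A B : Matrix (Fin n) (Fin m) 𝔽) :
    (A + B).rank ≤ A.rank + B.rank := by
  unfold Matrix.rank
  rw [Matrix.mulVecLin_add]
  exact (Submodule.finrank_mono (LinearMap.range_add_le _ _)).trans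
    (Submodule.finrank_add_le_finrank_add_finrank _ _)

/-- A matrix vanishing outside the first `s` rows has rank at most `s`. -/
theorem Matrix.rank_le_of_rows_eq_zero {𝔽 : Type*} [Field 𝔽] {n m s : ℕ}
    (A : Matrix (Fin n) (Fin m) 𝔽) (hA : ∀ (i : Fin n) (j : Fin m), s ≤ (i : ℕ) → A i j = 0) : A.rank ≤ s := by
  refine (A.rank_le_card_of_support_subset (Finset.univ.filter fun i : Fin n => (i : ℕ) < s)
    ?_).trans ((Fin.card_filter_val_lt).trans_le (min_le_right _ _))
  rw [Function.support_subset_iff']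
  intro i hi
  ext j
  exact hA i j (by simpa using hi)

/-- A matrix vanishing outside the first `k` columns has rank at most `k`. -/
theorem Matrix.rank_le_of_cols_eq_zero {𝔽 : Type*} [Field 𝔽] {n m k : ℕ}
    (A : Matrix (Fin n) (Fin m) 𝔽) (hA : ∀ (i : Fin n) (j : Fin m), k ≤ (j : ℕ) → A i j = 0) : A.rank ≤ k := by
  rw [← Matrix.rank_transpose]
  exact Aᵀ.rank_le_of_rows_eq_zero fun i j hi => hA j i hi

open Classical in
/-- Matrices supported on `P` are the functions on the set of positions satisfying `P`. -/
noncomputable def zeroOutsideEquiv (𝔽 : Type*) [Field 𝔽] {n m : ℕ} (P : Fin n → Fin m → Prop) :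
    (zeroOutside P : Submodule 𝔽 (Matrix (Fin n) (Fin m) 𝔽)) ≃ₗ[𝔽]
      ({p : Fin n × Fin m // P p.1 p.2} → 𝔽) where
  toFun A p := A.1 p.1.1 p.1.2
  map_add' _ _ := rfl
  map_smul' _ _ := rfl
  invFun f := ⟨fun i j => if hp : P i j then f ⟨(i, j), hp⟩ else 0, fun _ _ hp => dif_neg hp⟩
  left_inv A := by
    ext i j
    by_cases hp : P i j
    · simp [hp]
    · simpa [hp] using (A.2 i j hp).symm
  right_inv f := by
    ext ⟨⟨i, j⟩, hp⟩
    exact dif_pos hp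

open Classical in
theorem finrank_zeroOutside {𝔽 : Type*} [Field 𝔽] {n m : ℕ} (P : Fin n → Fin m → Prop) :
    Module.finrank 𝔽 (zeroOutside P : Submodule 𝔽 (Matrix (Fin n) (Fin m) 𝔽)) =
      ∑ i, (Finset.univ.filter (P i)).card := by
  rw [(zeroOutsideEquiv 𝔽 P).finrank_eq, Module.finrank_fintype_fun_eq_card, Fintype.card_subtype,
    Finset.card_filter, Fintype.sum_prod_type]
  simp only [Finset.card_filter]

/-- The support of `C_{s,h,k}`. -/
def stairSupport (n m s h k : ℕ) (i : Fin n) (j : Fin m) : Prop :=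
  (i : ℕ) < s ∨ ((i : ℕ) < s + h ∧ (j : ℕ) < k)

theorem finrank_zeroOutside_stairSupport {𝔽 : Type*} [Field 𝔽] {n m s h k : ℕ}
    (hshn : s + h ≤ n) (hk : k ≤ m) :
    Module.finrank 𝔽
      (zeroOutside (stairSupport n m s h k) : Submodule 𝔽 (Matrix (Fin n) (Fin m) 𝔽)) =
      s * m + h * k := by
  classical
  have hrow (i : Fin n) : (Finset.univ.filter (stairSupport n m s h k i)).card =
      if (i : ℕ) < s then m else if (i : ℕ) < s + h then k else 0 := by
    unfold stairSupport
    split_ifs with h1 h2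
    · simp [h1]
    · simp [h1, h2, Fin.card_filter_val_lt, hk]
    · simp [h1, h2]
  obtain ⟨t, rfl⟩ := Nat.exists_eq_add_of_le hshn
  rw [finrank_zeroOutside, Finset.sum_congr rfl fun i _ => hrow i,
    Fin.sum_univ_eq_sum_range (fun i => if i < s then m else if i < s + h then k else 0),
    Finset.sum_range_add, Finset.sum_range_add,
    Finset.sum_congr rfl fun i hi => if_pos (Finset.mem_range.1 hi),
    Finset.sum_congr rfl fun i hi => (if_neg (by omega)).trans
      (if_pos (by have := Finset.mem_range.1 hi; omega)),
    Finset.sum_eq_zero fun i _ => (if_neg (by omega)).trans (if_neg (by omega))]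
  simp

theorem rank_le_of_mem_zeroOutside_stairSupport {𝔽 : Type*} [Field 𝔽] {n m s h k : ℕ}
    {A : Matrix (Fin n) (Fin m) 𝔽} (hA : A ∈ zeroOutside (stairSupport n m s h k)) :
    A.rank ≤ s + min h k := by
  have h_rows : A.rank ≤ s + h := A.rank_le_of_rows_eq_zero fun i j hi => hA i j (by
    unfold stairSupport
    omega)
  let B : Matrix (Fin n) (Fin m) 𝔽 := Matrix.of fun i j => if (i : ℕ) < s then A i j else 0
  have hB : B.rank ≤ s := B.rank_le_of_rows_eq_zero fun i j hi => if_neg (by omega)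
  have hAB : (A - B).rank ≤ k := (A - B).rank_le_of_cols_eq_zero fun i j hj => by
    by_cases hi : (i : ℕ) < s
    · simp [B, hi]
    · simpa [B, hi] using hA i j (by
        unfold stairSupport
        omega)
  have h_cols := B.rank_add_le (A - B)
  rw [add_sub_cancel] at h_cols
  omega

theorem exists_mem_zeroOutside_stairSupport_rank_ge (𝔽 : Type*) [Field 𝔽] {n m s h k : ℕ}
    (hnm : n ≤ m) (hshn : s + h ≤ n) :
    ∃ A ∈ (zeroOutside (stairSupport n m s h k) : Submodule 𝔽 (Matrix (Fin n) (Fin m) 𝔽)),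
      s + min h k ≤ A.rank := by
  -- row `i < s` is sent to column `min h k + i`, row `s + i` to column `i`
  let c (i : ℕ) : ℕ := if i < s then min h k + i else i - s
  let A : Matrix (Fin n) (Fin m) 𝔽 := Matrix.of fun i j =>
    if (i : ℕ) < s + min h k ∧ (j : ℕ) = c i then 1 else 0
  have hc (i : Fin (s + min h k)) : c i < m := by
    simp only [c]
    split_ifs <;> omega
  refine ⟨A, fun i j hij => if_neg ?_, ?_⟩
  · rintro ⟨hi, hj⟩
    simp only [stairSupport, c] at hij hj
    split_ifs at hj <;> omega
  · let f : Fin (s + min h k) → Fin n := Fin.castLE (by omega)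
    let g : Fin (s + min h k) → Fin m := fun i => ⟨c i, hc i⟩
    have hone : A.submatrix f g = 1 := by
      ext i j
      have hcc : c j = c i ↔ i = j := by
        rw [Fin.ext_iff]
        simp only [c]
        split_ifs <;> omega
      have hi : (i : ℕ) < s + min h k := i.2
      simp only [A, f, g, Matrix.submatrix_apply, Matrix.of_apply, Fin.val_castLE, hcc, hi,
        true_and, Matrix.one_apply]
    have hrank := A.rank_submatrix_le f g
    rwa [hone, Matrix.rank_one, Fintype.card_fin] at hrank

theorem maxrk_zeroOutside_stairSupport {𝔽 : Type*} [Field 𝔽] {n m s h k : ℕ}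
    (hnm : n ≤ m) (hshn : s + h ≤ n) :
    maxrk (zeroOutside (stairSupport n m s h k) : Submodule 𝔽 (Matrix (Fin n) (Fin m) 𝔽)) =
      s + min h k := by
  obtain ⟨A, hA, hAr⟩ := exists_mem_zeroOutside_stairSupport_rank_ge 𝔽 (k := k) hnm hshn
  refine IsGreatest.csSup_eq ⟨⟨A, hA, ?_⟩, ?_⟩
  · exact (rank_le_of_mem_zeroOutside_stairSupport hA).antisymm hAr
  · rintro _ ⟨B, hB, rfl⟩
    exact rank_le_of_mem_zeroOutside_stairSupport hB

theorem natCast_eq_ceil_div_iff {a d m : ℕ} (hm : 0 < m) :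
    (a : ℤ) = ⌈(d : ℚ) / (m : ℚ)⌉ ↔ a * m < d + m ∧ d ≤ a * m := by
  have hm' : (0 : ℚ) < m := by exact_mod_cast hm
  rw [eq_comm, Int.ceil_eq_iff, lt_div_iff₀ hm', div_le_iff₀ hm', sub_mul, one_mul,
    sub_lt_iff_lt_add]
  norm_cast

theorem not_dvd_and_lt_iff {m r M : ℕ} (hM : M ≤ m) (hm : 0 < m) :
    (¬ m ∣ r * M ∧ r * m < r * M + m) ↔ 0 < r ∧ r ≤ (m - 1) / (m - M) := by
  rcases Nat.eq_zero_or_pos r with rfl | hr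
  · simp
  obtain ⟨d, rfl⟩ := Nat.exists_eq_add_of_le hM
  rcases Nat.eq_zero_or_pos d with rfl | hd
  · simp [hr.ne']
  rw [Nat.add_sub_cancel_left, Nat.le_div_iff_mul_le hd]
  have hrd : 0 < r * d := Nat.mul_pos hr hd
  constructor
  · rintro ⟨-, hlt⟩
    rw [mul_add] at hlt
    omega
  · rintro ⟨-, hle⟩
    have hlt : r * (M + d) < r * M + (M + d) := by
      rw [mul_add]
      omega
    refine ⟨?_, hlt⟩
    rintro ⟨t, ht⟩
    have h1 : (M + d) * t < (M + d) * r := by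
      rw [← ht, mul_comm _ r, mul_add]
      omega
    have h2 : (M + d) * r < (M + d) * (t + 1) := by
      rw [mul_add, ← ht, mul_comm _ r]
      omega
    have := Nat.lt_of_mul_lt_mul_left h1
    have := Nat.lt_of_mul_lt_mul_left h2
    omega

/-- `C_{s,h,k}` is a qOAC iff `0 < min{h,k} ≤ ⌊(m−1)/(m−max{h,k})⌋`. -/
theorem stmt5 {𝔽 : Type*} [Field 𝔽] [Fintype 𝔽] {n m s h k : ℕ} (hnm : n ≤ m)
    (hsh0 : 0 < s + h) (hshn : s + h ≤ n) (hk : k < m)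
    (C : Submodule 𝔽 (Matrix (Fin n) (Fin m) 𝔽))
    (hC : C = zeroOutside (fun (i : Fin n) (j : Fin m) =>
        (i : ℕ) < s ∨ ((i : ℕ) < s + h ∧ (j : ℕ) < k))) :
    isQOAC C ↔ (0 < min h k ∧ min h k ≤ (m - 1) / (m - max h k)) := by
  have hCs : C = zeroOutside (stairSupport n m s h k) := hC
  subst hCs
  have hm : 0 < m := by omega
  have hprod : h * k = min h k * max h k := (min_mul_max h k).symm
  have hle : min h k * max h k ≤ min h k * m := Nat.mul_le_mul_left _ (by omega)
  rw [isQOAC, finrank_zeroOutside_stairSupport hshn hk.le, maxrk_zeroOutside_stairSupport hnm hshn,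
    natCast_eq_ceil_div_iff hm, hprod, ← Nat.dvd_add_iff_right (dvd_mul_left m s),
    ← not_dvd_and_lt_iff (by omega) hm, add_mul]
  refine and_congr_right fun _ => ?_
  omega
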